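/- arXiv:1210.3426 — 2 statements merged into one kernel-verified Lean document; each statement's English description precedes it below -/
import Mathlib

section
/- Let M ∈ Mat_n(ℂ) be symmetric with positive-definite real part, let 0 < α < 2, and let f : ℝⁿ → ℂ be measurable with |f(x)| ≤ C e^{C‖x‖^α} for some C > 0. Then for every u ∈ ℂⁿ the integral F(u) = (2πħ)^(−n/2) ∫_{ℝⁿ} f(x) · exp( −(1/ħ) (u−x) M⁻¹ (u−x)ᵀ ) dx converges absolutely, and F is an entire (holomorphic) function on ℂⁿ. (Paper's Theorem: smearing the star-delta function against a function of growth order e^{|x|^α}, α < 2, yields an entire star-function.) -/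
open MeasureTheory

noncomputable section

/-- The bilinear form `a M bᵀ = ∑ᵢⱼ aᵢ Mᵢⱼ bⱼ` (no conjugation). -/
def bil {n : ℕ} (M : Matrix (Fin n) (Fin n) ℂ) (a b : Fin n → ℂ) : ℂ :=
  ∑ i, ∑ j, a i * M i j * b j

/-- Inclusion of a real row vector into ℂⁿ. -/
def cvec {n : ℕ} (x : Fin n → ℝ) : Fin n → ℂ := fun i => (x i : ℂ)

/-- The Hermitian form of a complex symmetric matrix with positive-definite real part has
positive real part. -/
lemma re_hermitian_form_pos {n : ℕ} {M : Matrix (Fin n) (Fin n) ℂ} (hsymm : M.IsSymm)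
    (hpos : ∀ ξ : Fin n → ℝ, ξ ≠ 0 → 0 < ∑ i, ∑ j, ξ i * (M i j).re * ξ j)
    {w : Fin n → ℂ} (hw : w ≠ 0) :
    0 < (∑ i, (starRingEnd ℂ) (w i) * M.mulVec w i).re := by
  have key : (∑ i, (starRingEnd ℂ) (w i) * M.mulVec w i).re =
      (∑ i, ∑ j, (w i).re * (M i j).re * (w j).re) +
      (∑ i, ∑ j, (w i).im * (M i j).re * (w j).im) := by
    have h0 : ∑ i, ∑ j, (M i j).im * (w i).re * (w j).im =
        ∑ i, ∑ j, (M i j).im * (w i).im * (w j).re := by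
      rw [Finset.sum_comm]
      refine Finset.sum_congr rfl fun i _ => Finset.sum_congr rfl fun j _ => ?_
      rw [← hsymm.apply i j]; ring
    have h1 : (∑ i, (starRingEnd ℂ) (w i) * M.mulVec w i).re =
      (∑ i, ∑ j, (w i).re * (M i j).re * (w j).re) +
      (∑ i, ∑ j, (w i).im * (M i j).re * (w j).im) +
      ((∑ i, ∑ j, (M i j).im * (w i).im * (w j).re) -
        ∑ i, ∑ j, (M i j).im * (w i).re * (w j).im) := by
      simp only [Matrix.mulVec, dotProduct, Finset.mul_sum, Complex.re_sum,
        ← Finset.sum_add_distrib, ← Finset.sum_sub_distrib]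
      refine Finset.sum_congr rfl fun i _ => Finset.sum_congr rfl fun j _ => ?_
      simp only [Complex.mul_re, Complex.mul_im, Complex.conj_re, Complex.conj_im]
      ring
    rw [h1, h0]; ring
  have nonneg (ξ : Fin n → ℝ) : 0 ≤ ∑ i, ∑ j, ξ i * (M i j).re * ξ j := by
    by_cases h : ξ = 0
    · simp [h]
    · exact (hpos ξ h).le
  rw [key]
  by_cases hre : (fun i => (w i).re) = 0
  · have him : (fun i => (w i).im) ≠ 0 := fun him =>
      hw (funext fun i => Complex.ext (congrFun hre i) (congrFun him i))
    exact add_pos_of_nonneg_of_pos (nonneg _) (hpos _ him)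
  · exact add_pos_of_pos_of_nonneg (hpos _ hre) (nonneg _)

lemma isUnit_det_of_re_posDef {n : ℕ} {M : Matrix (Fin n) (Fin n) ℂ} (hsymm : M.IsSymm)
    (hpos : ∀ ξ : Fin n → ℝ, ξ ≠ 0 → 0 < ∑ i, ∑ j, ξ i * (M i j).re * ξ j) :
    IsUnit M.det := by
  rw [isUnit_iff_ne_zero]
  intro h
  obtain ⟨w, hw, hMw⟩ := Matrix.exists_mulVec_eq_zero_iff.2 h
  simpa [hMw] using re_hermitian_form_pos hsymm hpos hw

/-- The inverse of a complex symmetric matrix with positive-definite real part has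
positive-definite real part. -/
lemma re_bil_inv_pos {n : ℕ} {M : Matrix (Fin n) (Fin n) ℂ} (hsymm : M.IsSymm)
    (hpos : ∀ ξ : Fin n → ℝ, ξ ≠ 0 → 0 < ∑ i, ∑ j, ξ i * (M i j).re * ξ j)
    {ξ : Fin n → ℝ} (hξ : ξ ≠ 0) : 0 < (bil M⁻¹ (cvec ξ) (cvec ξ)).re := by
  set w := M⁻¹.mulVec (cvec ξ) with hw
  have hMw : M.mulVec w = cvec ξ := by
    rw [hw, Matrix.mulVec_mulVec, Matrix.mul_nonsing_inv _ (isUnit_det_of_re_posDef hsymm hpos),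
      Matrix.one_mulVec]
  have hw0 : w ≠ 0 := by
    intro h
    rw [h, Matrix.mulVec_zero] at hMw
    exact hξ (funext fun i => by simpa [cvec] using (congrFun hMw i).symm)
  have h := re_hermitian_form_pos hsymm hpos hw0
  rw [hMw] at h
  convert h using 1
  have hb : bil M⁻¹ (cvec ξ) (cvec ξ) = ∑ i, cvec ξ i * w i := by
    simp [bil, hw, Matrix.mulVec, dotProduct, Finset.mul_sum, mul_assoc]
  rw [hb, Complex.re_sum, Complex.re_sum]
  refine Finset.sum_congr rfl fun i _ => ?_
  simp [cvec, mul_comm]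

lemma continuous_cvec {n : ℕ} : Continuous (cvec : (Fin n → ℝ) → Fin n → ℂ) := by
  unfold cvec
  fun_prop

lemma norm_cvec {n : ℕ} (x : Fin n → ℝ) : ‖cvec x‖ = ‖x‖ := by
  simp [Pi.norm_def, cvec]

lemma bil_sub_sub {n : ℕ} (A : Matrix (Fin n) (Fin n) ℂ) (a b : Fin n → ℂ) :
    bil A (a - b) (a - b) = bil A a a - bil A a b - bil A b a + bil A b b := by
  simp only [bil, ← Finset.sum_add_distrib, ← Finset.sum_sub_distrib, Pi.sub_apply]
  refine Finset.sum_congr rfl fun i _ => Finset.sum_congr rfl fun j _ => ?_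
  ring

lemma norm_bil_le {n : ℕ} (A : Matrix (Fin n) (Fin n) ℂ) (a b : Fin n → ℂ) :
    ‖bil A a b‖ ≤ (∑ i, ∑ j, ‖A i j‖) * ‖a‖ * ‖b‖ := by
  rw [bil]
  simp only [Finset.sum_mul]
  refine norm_sum_le_of_le _ fun i _ => norm_sum_le_of_le _ fun j _ => ?_
  rw [norm_mul, norm_mul, mul_comm ‖a i‖]
  gcongr
  · exact norm_le_pi_norm a i
  · exact norm_le_pi_norm b j

/-- A quadratic form that is positive on nonzero real vectors is coercive. -/
lemma exists_coercive_re_bil {n : ℕ} {A : Matrix (Fin n) (Fin n) ℂ}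
    (hA : ∀ ξ : Fin n → ℝ, ξ ≠ 0 → 0 < (bil A (cvec ξ) (cvec ξ)).re) :
    ∃ c > 0, ∀ x : Fin n → ℝ, c * ‖x‖ ^ 2 ≤ (bil A (cvec x) (cvec x)).re := by
  have hcont : Continuous fun x : Fin n → ℝ => (bil A (cvec x) (cvec x)).re := by
    unfold bil cvec
    fun_prop
  have hsmul (r : ℝ) (x : Fin n → ℝ) :
      (bil A (cvec (r • x)) (cvec (r • x))).re = r ^ 2 * (bil A (cvec x) (cvec x)).re := by
    rw [← Complex.re_ofReal_mul]
    congr 1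
    simp only [bil, cvec, Finset.mul_sum]
    refine Finset.sum_congr rfl fun i _ => Finset.sum_congr rfl fun j _ => ?_
    simp only [Pi.smul_apply, smul_eq_mul]
    push_cast
    ring
  obtain ⟨c, hc, hcs⟩ : ∃ c > 0, ∀ x ∈ Metric.sphere (0 : Fin n → ℝ) 1,
      c ≤ (bil A (cvec x) (cvec x)).re := by
    rcases (Metric.sphere (0 : Fin n → ℝ) 1).eq_empty_or_nonempty with h | h
    · exact ⟨1, one_pos, by simp [h]⟩
    · obtain ⟨y, hy, hmin⟩ := (isCompact_sphere (0 : Fin n → ℝ) 1).exists_isMinOn h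
        hcont.continuousOn
      exact ⟨_, hA y (ne_zero_of_mem_unit_sphere ⟨y, hy⟩), fun x hx => hmin hx⟩
  refine ⟨c, hc, fun x => ?_⟩
  by_cases hx : x = 0
  · simp [hx, bil, cvec]
  · have hx' : ‖x‖ ≠ 0 := norm_ne_zero_iff.2 hx
    have h := hcs (‖x‖⁻¹ • x) (by simp [norm_smul, hx'])
    rw [hsmul, inv_pow, inv_mul_eq_div, le_div_iff₀ (by positivity)] at h
    exact h

/-- Young-type inequality: a power below two is dominated by a small multiple of the square. -/
lemma exists_rpow_le_mul_sq_add {α ε : ℝ} (hα0 : 0 ≤ α) (hα2 : α < 2) (hε : 0 < ε) :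
    ∃ D, ∀ t : ℝ, 0 ≤ t → t ^ α ≤ ε * t ^ 2 + D := by
  set T : ℝ := ε ^ (1 / (α - 2)) with hT
  have hT0 : 0 < T := Real.rpow_pos_of_pos hε _
  refine ⟨T ^ α, fun t ht => ?_⟩
  rcases le_total t T with h | h
  · have := Real.rpow_le_rpow ht h hα0
    nlinarith [mul_nonneg hε.le (sq_nonneg t)]
  · have ht0 : 0 < t := hT0.trans_le h
    have h1 : t ^ (α - 2) ≤ ε := by
      calc t ^ (α - 2) ≤ T ^ (α - 2) := Real.rpow_le_rpow_of_nonpos hT0 h (by linarith)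
        _ = ε := by
          rw [hT, ← Real.rpow_mul hε.le, one_div_mul_cancel (by linarith), Real.rpow_one]
    have h2 : t ^ α = t ^ (α - 2) * t ^ 2 := by
      rw [← Real.rpow_natCast, ← Real.rpow_add ht0]; norm_num
    have h3 : 0 < T ^ α := Real.rpow_pos_of_pos hT0 _
    rw [h2]
    nlinarith [mul_le_mul_of_nonneg_right h1 (sq_nonneg t)]

lemma sum_sq_le_mul_norm_sq {n : ℕ} (x : Fin n → ℝ) : ∑ i, x i ^ 2 ≤ n * ‖x‖ ^ 2 := by
  calc ∑ i, x i ^ 2 ≤ ∑ _i : Fin n, ‖x‖ ^ 2 := Finset.sum_le_sum fun i _ => by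
        rw [← sq_abs (x i), ← Real.norm_eq_abs]
        gcongr
        exact norm_le_pi_norm x i
    _ = n * ‖x‖ ^ 2 := by simp

lemma integrable_exp_neg_mul_norm_sq {n : ℕ} {δ : ℝ} (hδ : 0 < δ) :
    Integrable fun x : Fin n → ℝ => Real.exp (-δ * ‖x‖ ^ 2) := by
  set b : ℝ := δ / (n + 1) with hb
  have hb0 : 0 < b := by positivity
  have h := (GaussianFourier.integrable_cexp_neg_mul_sum_add (ι := Fin n) (b := (b : ℂ))
    (by simpa using hb0) 0).norm
  refine h.mono' (by fun_prop) (Filter.Eventually.of_forall fun x => ?_)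
  rw [Real.norm_of_nonneg (Real.exp_pos _).le, Complex.norm_exp, Real.exp_le_exp]
  have e : (-(b : ℂ) * ∑ i, (x i : ℂ) ^ 2 + ∑ i, (0 : Fin n → ℂ) i * (x i : ℂ)).re =
      -(b * ∑ i, x i ^ 2) := by
    have : (-(b : ℂ) * ∑ i, (x i : ℂ) ^ 2 + ∑ i, (0 : Fin n → ℂ) i * (x i : ℂ)) =
      ((-(b * ∑ i, x i ^ 2) : ℝ) : ℂ) := by simp
    rw [this, Complex.ofReal_re]
  rw [e, neg_mul, neg_le_neg_iff]
  have h1 := sum_sq_le_mul_norm_sq x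
  calc b * ∑ i, x i ^ 2 ≤ b * ((n + 1) * ‖x‖ ^ 2) := by
        gcongr
        nlinarith [sq_nonneg ‖x‖]
    _ = δ * ‖x‖ ^ 2 := by rw [hb]; field_simp

/-- The derivative of `u ↦ bil A u u` at `w`. -/
def bilDeriv {n : ℕ} (A : Matrix (Fin n) (Fin n) ℂ) (w : Fin n → ℂ) : (Fin n → ℂ) →L[ℂ] ℂ :=
  ∑ i, ∑ j, A i j • (w j • ContinuousLinearMap.proj (R := ℂ) (φ := fun _ : Fin n => ℂ) i +
    w i • ContinuousLinearMap.proj (R := ℂ) (φ := fun _ : Fin n => ℂ) j)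

lemma bilDeriv_apply {n : ℕ} (A : Matrix (Fin n) (Fin n) ℂ) (w h : Fin n → ℂ) :
    bilDeriv A w h = bil A h w + bil A w h := by
  simp only [bilDeriv, bil, sum_apply, smul_apply,
    add_apply, ContinuousLinearMap.proj_apply, smul_eq_mul,
    ← Finset.sum_add_distrib]
  refine Finset.sum_congr rfl fun i _ => Finset.sum_congr rfl fun j _ => ?_
  ring

lemma continuous_bilDeriv {n : ℕ} (A : Matrix (Fin n) (Fin n) ℂ) : Continuous (bilDeriv A) := by
  unfold bilDeriv
  fun_prop

lemma norm_bilDeriv_le {n : ℕ} (A : Matrix (Fin n) (Fin n) ℂ) (w : Fin n → ℂ) :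
    ‖bilDeriv A w‖ ≤ 2 * (∑ i, ∑ j, ‖A i j‖) * ‖w‖ := by
  refine ContinuousLinearMap.opNorm_le_bound _ (by positivity) fun h => ?_
  rw [bilDeriv_apply]
  refine (norm_add_le_of_le (norm_bil_le A h w) (norm_bil_le A w h)).trans_eq ?_
  ring

lemma hasFDerivAt_bil_sub {n : ℕ} (A : Matrix (Fin n) (Fin n) ℂ) (u y : Fin n → ℂ) :
    HasFDerivAt (fun u => bil A (u - y) (u - y)) (bilDeriv A (u - y)) u := by
  unfold bil bilDeriv
  refine HasFDerivAt.fun_sum fun i _ => HasFDerivAt.fun_sum fun j _ => ?_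
  have hp (k : Fin n) : HasFDerivAt (fun u : Fin n → ℂ => (u - y) k)
      (ContinuousLinearMap.proj (R := ℂ) (φ := fun _ : Fin n => ℂ) k) u :=
    (hasFDerivAt_apply k u).sub_const (y k)
  refine (((hp i).mul_const (A i j)).mul (hp j)).congr_fderiv ?_
  ext h
  simp
  ring

/-- Locally uniform Gaussian domination of the smeared kernel, with room for a linear factor. -/
lemma exists_gaussian_bound {n : ℕ} {ℏ : ℝ} (hℏ : 0 < ℏ) {A : Matrix (Fin n) (Fin n) ℂ}
    (hA : ∀ ξ : Fin n → ℝ, ξ ≠ 0 → 0 < (bil A (cvec ξ) (cvec ξ)).re)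
    {α : ℝ} (hα0 : 0 < α) (hα2 : α < 2) {f : (Fin n → ℝ) → ℂ} {C : ℝ} (hC : 0 < C)
    (hgrowth : ∀ x : Fin n → ℝ,
      ‖f x‖ ≤ C * Real.exp (C * (Real.sqrt (∑ i, x i ^ 2)) ^ α)) (R : ℝ) (hR : 0 ≤ R) :
    ∃ B δ, 0 < δ ∧ ∀ u : Fin n → ℂ, ‖u‖ ≤ R → ∀ x : Fin n → ℝ,
      ‖f x * Complex.exp (-(1 / (ℏ : ℂ)) * bil A (u - cvec x) (u - cvec x))‖ * (1 + ‖x‖) ≤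
        B * Real.exp (-δ * ‖x‖ ^ 2) := by
  obtain ⟨c, hc, hcoer⟩ := exists_coercive_re_bil hA
  set K := ∑ i, ∑ j, ‖A i j‖ with hK
  have hK0 : 0 ≤ K := by positivity
  set C' := C * Real.sqrt n ^ α with hC'
  have hC'0 : 0 ≤ C' := by positivity
  set δ := c / ℏ / 4 with hδ
  have hδ0 : 0 < δ := by positivity
  set b := 2 * K * R / ℏ + 1 with hb
  have hb0 : 0 < b := by positivity
  obtain ⟨D₁, hD₁⟩ := exists_rpow_le_mul_sq_add hα0.le hα2 (ε := δ / (C' + 1)) (by positivity)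
  obtain ⟨D₂, hD₂⟩ := exists_rpow_le_mul_sq_add (α := 1) zero_le_one one_lt_two
    (ε := δ / b) (by positivity)
  refine ⟨C * Real.exp (C' * D₁ + b * D₂ + K * R ^ 2 / ℏ), δ, hδ0, fun u hu x => ?_⟩
  set t := ‖x‖ with ht
  have ht0 : 0 ≤ t := norm_nonneg x
  have hf : ‖f x‖ ≤ C * Real.exp (C' * t ^ α) := by
    refine (hgrowth x).trans ?_
    rw [hC', mul_assoc, ← Real.mul_rpow (Real.sqrt_nonneg _) ht0]
    gcongr
    refine (Real.sqrt_le_sqrt (sum_sq_le_mul_norm_sq x)).trans_eq ?_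
    rw [Real.sqrt_mul (Nat.cast_nonneg n), Real.sqrt_sq ht0]
  have hre : c * t ^ 2 - K * R ^ 2 - 2 * K * R * t ≤
      (bil A (u - cvec x) (u - cvec x)).re := by
    rw [bil_sub_sub, Complex.add_re, Complex.sub_re, Complex.sub_re]
    have h1 := (abs_le.1 ((Complex.abs_re_le_norm _).trans (norm_bil_le A u u))).1
    have h2 := (abs_le.1 ((Complex.abs_re_le_norm _).trans (norm_bil_le A u (cvec x)))).2
    have h3 := (abs_le.1 ((Complex.abs_re_le_norm _).trans (norm_bil_le A (cvec x) u))).2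
    rw [norm_cvec, ← hK, ← ht] at h2 h3
    rw [← hK] at h1
    have h4 := hcoer x
    have h5 : K * ‖u‖ * ‖u‖ ≤ K * R * R := by gcongr
    have h6 : K * ‖u‖ * t ≤ K * R * t := by gcongr
    nlinarith
  have hexp : ‖Complex.exp (-(1 / (ℏ : ℂ)) * bil A (u - cvec x) (u - cvec x))‖ ≤
      Real.exp (-(4 * δ * t ^ 2) + K * R ^ 2 / ℏ + 2 * K * R / ℏ * t) := by
    rw [Complex.norm_exp, Real.exp_le_exp]
    have e : (-(1 / (ℏ : ℂ)) * bil A (u - cvec x) (u - cvec x)).re =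
        -(bil A (u - cvec x) (u - cvec x)).re / ℏ := by
      have : -(1 / (ℏ : ℂ)) = ((-(1 / ℏ) : ℝ) : ℂ) := by push_cast; rfl
      rw [this, Complex.re_ofReal_mul]; ring
    rw [e, div_le_iff₀ hℏ]
    have : (-(4 * δ * t ^ 2) + K * R ^ 2 / ℏ + 2 * K * R / ℏ * t) * ℏ =
        -(c * t ^ 2 - K * R ^ 2 - 2 * K * R * t) := by
      rw [hδ]; field_simp; ring
    rw [this]; linarith
  have ht1 : 1 + t ≤ Real.exp t := by linarith [Real.add_one_le_exp t]
  rw [norm_mul]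
  calc ‖f x‖ * ‖Complex.exp (-(1 / (ℏ : ℂ)) * bil A (u - cvec x) (u - cvec x))‖ * (1 + t)
      ≤ C * Real.exp (C' * t ^ α) *
          Real.exp (-(4 * δ * t ^ 2) + K * R ^ 2 / ℏ + 2 * K * R / ℏ * t) * Real.exp t := by
        gcongr
    _ = C * Real.exp (C' * t ^ α + b * t + K * R ^ 2 / ℏ - 4 * δ * t ^ 2) := by
        rw [mul_assoc, mul_assoc, ← Real.exp_add, ← Real.exp_add, hb]
        ring_nf
    _ ≤ C * Real.exp (C' * D₁ + b * D₂ + K * R ^ 2 / ℏ + -δ * t ^ 2) := by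
        gcongr
        have h1 : C' * t ^ α ≤ δ * t ^ 2 + C' * D₁ := by
          have h := mul_le_mul_of_nonneg_left (hD₁ t ht0) hC'0
          have h' : C' * (δ / (C' + 1)) ≤ δ := by
            rw [mul_div_assoc', div_le_iff₀ (by positivity)]; nlinarith
          nlinarith [mul_le_mul_of_nonneg_right h' (sq_nonneg t)]
        have h2 : b * t ≤ δ * t ^ 2 + b * D₂ := by
          have h := mul_le_mul_of_nonneg_left (hD₂ t ht0) hb0.le
          rw [Real.rpow_one] at h
          have h' : b * (δ / b) = δ := mul_div_cancel₀ _ hb0.ne'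
          calc b * t ≤ b * (δ / b * t ^ 2 + D₂) := h
            _ = b * (δ / b) * t ^ 2 + b * D₂ := by ring
            _ = _ := by rw [h']
        nlinarith [mul_nonneg hδ0.le (sq_nonneg t)]
    _ = _ := by rw [Real.exp_add]; ring

/-- smearing the star-delta function against a measurable function of growth
order `e^{C‖x‖^α}` with `0 < α < 2` gives an absolutely convergent integral for each
`u ∈ ℂⁿ`, and the resulting function is entire. -/
theorem stmt5 {n : ℕ} (ℏ : ℝ) (hℏ : 0 < ℏ)
    (M : Matrix (Fin n) (Fin n) ℂ) (hsymm : M.IsSymm)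
    (hpos : ∀ ξ : Fin n → ℝ, ξ ≠ 0 → 0 < ∑ i, ∑ j, ξ i * (M i j).re * ξ j)
    (α : ℝ) (hα0 : 0 < α) (hα2 : α < 2)
    (f : (Fin n → ℝ) → ℂ) (hf : Measurable f)
    (C : ℝ) (hC : 0 < C)
    (hgrowth : ∀ x : Fin n → ℝ,
      ‖f x‖ ≤ C * Real.exp (C * (Real.sqrt (∑ i, x i ^ 2)) ^ α)) :
    (∀ u : Fin n → ℂ,
      Integrable (fun x : Fin n → ℝ =>
        f x * Complex.exp (-(1 / (ℏ : ℂ)) * bil M⁻¹ (u - cvec x) (u - cvec x))) volume) ∧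
    Differentiable ℂ (fun u : Fin n → ℂ =>
      (((Real.sqrt (2 * Real.pi * ℏ))⁻¹ ^ n : ℝ) : ℂ) *
        ∫ x : Fin n → ℝ,
          f x * Complex.exp (-(1 / (ℏ : ℂ)) * bil M⁻¹ (u - cvec x) (u - cvec x))) := by
  have hA : ∀ ξ : Fin n → ℝ, ξ ≠ 0 → 0 < (bil M⁻¹ (cvec ξ) (cvec ξ)).re :=
    fun ξ hξ => re_bil_inv_pos hsymm hpos hξ
  have hmeas (u : Fin n → ℂ) : AEStronglyMeasurable (fun x : Fin n → ℝ =>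
      f x * Complex.exp (-(1 / (ℏ : ℂ)) * bil M⁻¹ (u - cvec x) (u - cvec x))) volume := by
    have h : Continuous fun x : Fin n → ℝ =>
        Complex.exp (-(1 / (ℏ : ℂ)) * bil M⁻¹ (u - cvec x) (u - cvec x)) := by
      unfold bil cvec
      fun_prop
    exact hf.aestronglyMeasurable.mul h.aestronglyMeasurable
  have hint (u : Fin n → ℂ) : Integrable (fun x : Fin n → ℝ =>
      f x * Complex.exp (-(1 / (ℏ : ℂ)) * bil M⁻¹ (u - cvec x) (u - cvec x))) volume := by
    obtain ⟨B, δ, hδ, h⟩ :=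
      exists_gaussian_bound hℏ hA hα0 hα2 hC hgrowth ‖u‖ (norm_nonneg u)
    refine ((integrable_exp_neg_mul_norm_sq hδ).const_mul B).mono' (hmeas u)
      (Filter.Eventually.of_forall fun x => le_trans ?_ (h u le_rfl x))
    exact le_mul_of_one_le_right (norm_nonneg _) (by linarith [norm_nonneg x])
  refine ⟨hint, Differentiable.const_mul (fun u₀ => ?_) _⟩
  set R := ‖u₀‖ + 1 with hR
  have hR0 : 0 ≤ R := by positivity
  set K := ∑ i, ∑ j, ‖M⁻¹ i j‖ with hK
  obtain ⟨B, δ, hδ, h⟩ := exists_gaussian_bound hℏ hA hα0 hα2 hC hgrowth R hR0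
  refine (hasFDerivAt_integral_of_dominated_of_fderiv_le (𝕜 := ℂ) (μ := volume)
    (F' := fun u x => (f x * Complex.exp (-(1 / (ℏ : ℂ)) * bil M⁻¹ (u - cvec x) (u - cvec x))) •
      (-(1 / (ℏ : ℂ))) • bilDeriv M⁻¹ (u - cvec x))
    (bound := fun x => ‖-(1 / (ℏ : ℂ))‖ * (2 * K * (R + 1)) * (B * Real.exp (-δ * ‖x‖ ^ 2)))
    (Metric.ball_mem_nhds u₀ one_pos) (Filter.Eventually.of_forall hmeas) (hint u₀) ?_ ?_ ?_
    ?_).differentiableAt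
  · refine (hmeas u₀).smul (Continuous.aestronglyMeasurable ?_)
    exact ((continuous_bilDeriv M⁻¹).comp
      ((continuous_const (y := u₀)).sub continuous_cvec)).const_smul (-(1 / (ℏ : ℂ)))
  · refine Filter.Eventually.of_forall fun x u hu => ?_
    have hu' : ‖u‖ ≤ R := by
      have h1 := norm_le_norm_add_norm_sub' u u₀
      rw [mem_ball_iff_norm] at hu
      linarith
    have h1 : ‖u - cvec x‖ ≤ (R + 1) * (1 + ‖x‖) := by
      have h2 := norm_sub_le u (cvec x)
      rw [norm_cvec] at h2
      nlinarith [mul_nonneg hR0 (norm_nonneg x)]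
    have hK0 : 0 ≤ K := by positivity
    rw [norm_smul, norm_smul]
    set E := ‖f x * Complex.exp (-(1 / (ℏ : ℂ)) * bil M⁻¹ (u - cvec x) (u - cvec x))‖
    calc E * (‖-(1 / (ℏ : ℂ))‖ * ‖bilDeriv M⁻¹ (u - cvec x)‖)
        ≤ E * (‖-(1 / (ℏ : ℂ))‖ * (2 * K * ((R + 1) * (1 + ‖x‖)))) := by
          gcongr
          exact (norm_bilDeriv_le _ _).trans (by gcongr)
      _ = ‖-(1 / (ℏ : ℂ))‖ * (2 * K * (R + 1)) * (E * (1 + ‖x‖)) := by ring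
      _ ≤ _ := by
          exact mul_le_mul_of_nonneg_left (h u hu' x) (by positivity)
  · exact ((integrable_exp_neg_mul_norm_sq hδ).const_mul B).const_mul _
  · refine Filter.Eventually.of_forall fun x u _ => ?_
    refine (((hasFDerivAt_bil_sub M⁻¹ u (cvec x)).const_mul _).cexp.const_mul
      (f x)).congr_fderiv ?_
    rw [smul_smul, smul_smul]

end
end

section
/- For every symmetric K ∈ Mat_{2m}(ℂ), the K-ordered product *_K makes ℂ[u₁,…,u_{2m}] a unital associative ℂ-algebra with unit the constant polynomial 1, and the generators satisfy u_i *_K u_j − u_j *_K u_i = iħ J_{ij} for all i, j. In particular, writing ũ_k = u_k and ṽ_l = u_{m+l} (1 ≤ k, l ≤ m), the Weyl algebra relations hold: [ũ_k, ṽ_l] = −iħ δ_{kl}, [ũ_k, ũ_l] = 0 = [ṽ_k, ṽ_l], where [a,b] = a *_K b − b *_K a. -/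
noncomputable section

variable {ι : Type} [Fintype ι] [DecidableEq ι]

/-- Iterated partial derivatives of a polynomial along a list of indices. -/
def pdsP : List ι → MvPolynomial ι ℂ → MvPolynomial ι ℂ
  | [], f => f
  | i :: l, f => MvPolynomial.pderiv i (pdsP l f)

/-- The K-ordered product on polynomials, with `Λ = K + J`; the series terminates at the
total degree of the first factor. -/
def starP (ℏ : ℝ) (Λ : Matrix ι ι ℂ) (f g : MvPolynomial ι ℂ) : MvPolynomial ι ℂ :=
  ∑ k ∈ Finset.range (f.totalDegree + 1),
    ((Complex.I * ℏ) ^ k / ((k.factorial : ℂ) * 2 ^ k)) •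
      ∑ p : (Fin k → ι) × (Fin k → ι),
        (∏ t, Λ (p.1 t) (p.2 t)) • (pdsP (List.ofFn p.1) f * pdsP (List.ofFn p.2) g)

section StarProduct

open MvPolynomial Finset

lemma pderiv_comm {σ R : Type*} [CommRing R] (i j : σ) (f : MvPolynomial σ R) :
    pderiv i (pderiv j f) = pderiv j (pderiv i f) := by
  classical
  have h : ⁅pderiv (R := R) i, pderiv (R := R) j⁆ = 0 := by
    apply MvPolynomial.derivation_ext
    intro k
    rw [Derivation.commutator_apply, pderiv_X, pderiv_X]
    by_cases hi : k = i <;> by_cases hj : k = j <;> simp [Pi.single_apply, hi, hj, apply_ite]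
  simpa [Derivation.commutator_apply, sub_eq_zero] using congrArg (fun D => D f) h

lemma totalDegree_pderiv_le {σ R : Type*} [CommSemiring R] (i : σ) (f : MvPolynomial σ R) :
    (pderiv i f).totalDegree ≤ f.totalDegree - 1 := by
  classical
  refine Finset.sup_le (s := (pderiv i f).support) fun s hs => ?_
  rw [mem_support_iff, coeff_pderiv] at hs
  have h := le_totalDegree (mem_support_iff.2 (left_ne_zero_of_mul hs))
  rw [Finsupp.sum_add_index' (fun _ => rfl) (fun _ _ _ => rfl),
    Finsupp.sum_single_index rfl] at h
  omega

variable {σ : Type}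

lemma pdsP_pderiv (l : List σ) (i : σ) (f : MvPolynomial σ ℂ) :
    pdsP l (pderiv i f) = pderiv i (pdsP l f) := by
  induction l with
  | nil => rfl
  | cons j l ih => simp only [pdsP, ih, pderiv_comm i j]

variable [Fintype σ]

/-- The `k`-th power of the bidifferential operator `∑ Λ i j • ∂ᵢ ⊗ ∂ⱼ`, followed by
multiplication. -/
def bidiff (Λ : Matrix σ σ ℂ) :
    ℕ → MvPolynomial σ ℂ →ₗ[ℂ] MvPolynomial σ ℂ →ₗ[ℂ] MvPolynomial σ ℂ
  | 0 => LinearMap.mul ℂ _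
  | k + 1 => ∑ i, ∑ j, Λ i j •
      (bidiff Λ k).compl₁₂ (pderiv i).toLinearMap (pderiv j).toLinearMap

variable (Λ : Matrix σ σ ℂ)

lemma bidiff_zero (f g : MvPolynomial σ ℂ) : bidiff Λ 0 f g = f * g := rfl

lemma bidiff_succ (k : ℕ) (f g : MvPolynomial σ ℂ) :
    bidiff Λ (k + 1) f g = ∑ i, ∑ j, Λ i j • bidiff Λ k (pderiv i f) (pderiv j g) := by
  simp [bidiff, LinearMap.sum_apply]

lemma bidiff_eq_sum (k : ℕ) (f g : MvPolynomial σ ℂ) :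
    bidiff Λ k f g = ∑ p : (Fin k → σ) × (Fin k → σ),
      (∏ t, Λ (p.1 t) (p.2 t)) • (pdsP (List.ofFn p.1) f * pdsP (List.ofFn p.2) g) := by
  induction k generalizing f g with
  | zero => simp [bidiff_zero, pdsP]
  | succ k ih =>
    simp only [bidiff_succ, ih, Fintype.sum_prod_type]
    simp only [← (Fin.consEquiv (fun _ : Fin (k + 1) => σ)).sum_comp, Fintype.sum_prod_type]
    refine Finset.sum_congr rfl fun i _ => ?_
    simp only [smul_sum]
    rw [Finset.sum_comm]
    simp [Fin.consEquiv, Fin.prod_univ_succ, pdsP, pdsP_pderiv, smul_smul]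

lemma bidiff_eq_zero {k : ℕ} {f : MvPolynomial σ ℂ} (hf : f.totalDegree < k)
    (g : MvPolynomial σ ℂ) : bidiff Λ k f g = 0 := by
  induction k generalizing f g with
  | zero => omega
  | succ k ih =>
    rw [bidiff_succ]
    refine Finset.sum_eq_zero fun i _ => Finset.sum_eq_zero fun j _ => ?_
    have hi := totalDegree_pderiv_le i f
    by_cases h : f.totalDegree = 0
    · rw [totalDegree_eq_zero_iff_eq_C] at h
      rw [h, pderiv_C, map_zero, LinearMap.zero_apply, smul_zero]
    · rw [ih (by omega), smul_zero]

lemma pderiv_bidiff (k : ℕ) (a : σ) (f g : MvPolynomial σ ℂ) :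
    pderiv a (bidiff Λ k f g) = bidiff Λ k (pderiv a f) g + bidiff Λ k f (pderiv a g) := by
  induction k generalizing f g with
  | zero => simp only [bidiff_zero, pderiv_mul]
  | succ k ih =>
    simp only [bidiff_succ, map_sum, Derivation.map_smul, ih, smul_add, sum_add_distrib,
      pderiv_comm a]

lemma bidiff_X_mul (k : ℕ) (a : σ) (f g : MvPolynomial σ ℂ) :
    bidiff Λ (k + 1) (X a * f) g = X a * bidiff Λ (k + 1) f g +
      ((k : ℂ) + 1) • ∑ j, Λ a j • bidiff Λ k f (pderiv j g) := by
  have expand (k : ℕ) (f g : MvPolynomial σ ℂ) : bidiff Λ (k + 1) (X a * f) g =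
      (∑ j, Λ a j • bidiff Λ k f (pderiv j g)) +
        ∑ i, ∑ j, Λ i j • bidiff Λ k (X a * pderiv i f) (pderiv j g) := by
    classical
    have h (i j : σ) : Λ i j • bidiff Λ k (pderiv i (X a * f)) (pderiv j g) =
        (if a = i then Λ i j • bidiff Λ k f (pderiv j g) else 0) +
          Λ i j • bidiff Λ k (X a * pderiv i f) (pderiv j g) := by
      rw [pderiv_mul, pderiv_X, map_add, LinearMap.add_apply, smul_add]
      by_cases hi : a = i <;> simp [hi]
    simp only [bidiff_succ, h, sum_add_distrib]
    congr 1
    rw [Finset.sum_comm]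
    simp
  induction k generalizing f g with
  | zero =>
    rw [expand]
    simp [bidiff_succ, bidiff_zero, mul_sum, mul_assoc, add_comm]
  | succ k ih =>
    rw [expand]
    have swap : ∑ i, ∑ j, Λ i j • ∑ l, Λ a l •
        bidiff Λ k (pderiv i f) (pderiv l (pderiv j g)) =
          ∑ l, Λ a l • bidiff Λ (k + 1) f (pderiv l g) := by
      simp only [bidiff_succ, smul_sum]
      conv_rhs => rw [Finset.sum_comm]
      refine Finset.sum_congr rfl fun i _ => ?_
      rw [Finset.sum_comm]
      refine Finset.sum_congr rfl fun l _ => Finset.sum_congr rfl fun j _ => ?_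
      rw [smul_comm, pderiv_comm l j]
    have step : ∑ i, ∑ j, Λ i j • bidiff Λ (k + 1) (X a * pderiv i f) (pderiv j g) =
        X a * bidiff Λ (k + 2) f g +
          ((k : ℂ) + 1) • ∑ l, Λ a l • bidiff Λ (k + 1) f (pderiv l g) := by
      rw [← swap, bidiff_succ Λ (k + 1)]
      simp only [ih, smul_add, sum_add_distrib, mul_sum, mul_smul_comm, smul_sum]
      simp only [smul_comm ((k : ℂ) + 1)]
    rw [step]
    push_cast
    module

lemma starP_eq_sum (ℏ : ℝ) {N : ℕ} {f : MvPolynomial σ ℂ} (hN : f.totalDegree < N)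
    (g : MvPolynomial σ ℂ) :
    starP ℏ Λ f g = ∑ k ∈ range N,
      ((Complex.I * ℏ) ^ k / ((k.factorial : ℂ) * 2 ^ k)) • bidiff Λ k f g := by
  simp only [starP, ← bidiff_eq_sum]
  refine Finset.sum_subset (range_subset_range.2 hN) fun k _ hk => ?_
  rw [bidiff_eq_zero Λ (by simpa using hk), smul_zero]

variable (ℏ : ℝ)

lemma starP_add_left (f g h : MvPolynomial σ ℂ) :
    starP ℏ Λ (f + g) h = starP ℏ Λ f h + starP ℏ Λ g h := by
  have hfg := totalDegree_add f g
  rw [starP_eq_sum Λ ℏ (N := max f.totalDegree g.totalDegree + 1) (by omega),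
    starP_eq_sum Λ ℏ (N := max f.totalDegree g.totalDegree + 1) (by omega),
    starP_eq_sum Λ ℏ (N := max f.totalDegree g.totalDegree + 1) (by omega)]
  simp only [map_add, LinearMap.add_apply, smul_add, sum_add_distrib]

lemma starP_add_right (f g h : MvPolynomial σ ℂ) :
    starP ℏ Λ f (g + h) = starP ℏ Λ f g + starP ℏ Λ f h := by
  simp only [starP_eq_sum Λ ℏ (Nat.lt_succ_self f.totalDegree), map_add, smul_add,
    sum_add_distrib]

lemma starP_smul_left (c : ℂ) (f g : MvPolynomial σ ℂ) :
    starP ℏ Λ (c • f) g = c • starP ℏ Λ f g := by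
  have hc := totalDegree_smul_le c f
  rw [starP_eq_sum Λ ℏ (N := f.totalDegree + 1) (by omega),
    starP_eq_sum Λ ℏ (N := f.totalDegree + 1) (by omega)]
  simp only [map_smul, LinearMap.smul_apply, smul_sum, smul_comm c]

lemma starP_smul_right (c : ℂ) (f g : MvPolynomial σ ℂ) :
    starP ℏ Λ f (c • g) = c • starP ℏ Λ f g := by
  simp only [starP_eq_sum Λ ℏ (Nat.lt_succ_self f.totalDegree), map_smul, smul_sum,
    smul_comm c]

/-- The star product as a bilinear map. -/
def starLin : MvPolynomial σ ℂ →ₗ[ℂ] MvPolynomial σ ℂ →ₗ[ℂ] MvPolynomial σ ℂ :=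
  LinearMap.mk₂ ℂ (starP ℏ Λ) (starP_add_left Λ ℏ) (starP_smul_left Λ ℏ)
    (starP_add_right Λ ℏ) (starP_smul_right Λ ℏ)

lemma starLin_apply (f g : MvPolynomial σ ℂ) : starLin Λ ℏ f g = starP ℏ Λ f g := rfl

lemma starLin_C (c : ℂ) (g : MvPolynomial σ ℂ) : starLin Λ ℏ (C c) g = c • g := by
  rw [starLin_apply, starP_eq_sum Λ ℏ (N := 1) (by simp)]
  simp [bidiff_zero, smul_eq_C_mul]

lemma pderiv_starLin (a : σ) (f g : MvPolynomial σ ℂ) :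
    pderiv a (starLin Λ ℏ f g) = starLin Λ ℏ (pderiv a f) g + starLin Λ ℏ f (pderiv a g) := by
  have h := totalDegree_pderiv_le a f
  simp only [starLin_apply]
  rw [starP_eq_sum Λ ℏ (N := f.totalDegree + 1) (by omega),
    starP_eq_sum Λ ℏ (N := f.totalDegree + 1) (by omega),
    starP_eq_sum Λ ℏ (N := f.totalDegree + 1) (by omega)]
  simp only [map_sum, Derivation.map_smul, pderiv_bidiff, smul_add, sum_add_distrib]

lemma starLin_X_mul (a : σ) (f g : MvPolynomial σ ℂ) :
    starLin Λ ℏ (X a * f) g = X a * starLin Λ ℏ f g +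
      (Complex.I * ℏ / 2) • ∑ j, Λ a j • starLin Λ ℏ f (pderiv j g) := by
  have h := totalDegree_mul (X a) f
  rw [totalDegree_X] at h
  have hcoeff (k : ℕ) :
      (Complex.I * ℏ) ^ (k + 1) / (((k + 1).factorial : ℂ) * 2 ^ (k + 1)) * ((k : ℂ) + 1) =
        Complex.I * ℏ / 2 * ((Complex.I * ℏ) ^ k / ((k.factorial : ℂ) * 2 ^ k)) := by
    have hk : (k : ℂ) + 1 ≠ 0 := Nat.cast_add_one_ne_zero k
    have hk' : (k.factorial : ℂ) ≠ 0 := Nat.cast_ne_zero.2 k.factorial_ne_zero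
    rw [Nat.factorial_succ]
    push_cast
    field_simp
    ring
  have hsum : ∑ j, Λ a j • starP ℏ Λ f (pderiv j g) = ∑ k ∈ range (f.totalDegree + 1),
      ((Complex.I * ℏ) ^ k / ((k.factorial : ℂ) * 2 ^ k)) •
        ∑ j, Λ a j • bidiff Λ k f (pderiv j g) := by
    simp only [starP_eq_sum Λ ℏ (Nat.lt_succ_self f.totalDegree), smul_sum]
    rw [Finset.sum_comm]
    simp only [smul_comm (Λ a _)]
  have hterm (k : ℕ) :
      ((Complex.I * ℏ) ^ (k + 1) / (((k + 1).factorial : ℂ) * 2 ^ (k + 1))) •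
          bidiff Λ (k + 1) (X a * f) g =
        X a * (((Complex.I * ℏ) ^ (k + 1) / (((k + 1).factorial : ℂ) * 2 ^ (k + 1))) •
          bidiff Λ (k + 1) f g) +
        (Complex.I * ℏ / 2) • ((Complex.I * ℏ) ^ k / ((k.factorial : ℂ) * 2 ^ k)) •
          ∑ j, Λ a j • bidiff Λ k f (pderiv j g) := by
    rw [bidiff_X_mul, smul_add, smul_smul, hcoeff, mul_smul, mul_smul_comm]
  simp only [starLin_apply, hsum]
  rw [starP_eq_sum Λ ℏ (N := f.totalDegree + 1 + 1) (by omega),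
    starP_eq_sum Λ ℏ (N := f.totalDegree + 1 + 1) (by omega), sum_range_succ' _ (f.totalDegree + 1),
    sum_range_succ' _ (f.totalDegree + 1)]
  simp only [hterm, sum_add_distrib, ← mul_sum, ← smul_sum]
  rw [bidiff_zero, bidiff_zero, mul_assoc, mul_add, mul_smul_comm]
  exact add_right_comm _ _ _

lemma starLin_one_left (f : MvPolynomial σ ℂ) : starLin Λ ℏ 1 f = f := by
  simpa using starLin_C Λ ℏ 1 f

lemma starLin_one_right (f : MvPolynomial σ ℂ) : starLin Λ ℏ f 1 = f := by
  induction f using MvPolynomial.induction_on with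
  | C c => rw [starLin_C, smul_eq_C_mul, mul_one]
  | add p q hp hq => rw [map_add, LinearMap.add_apply, hp, hq]
  | mul_X p a hp => rw [mul_comm, starLin_X_mul, hp]; simp

lemma starLin_assoc (f g h : MvPolynomial σ ℂ) :
    starLin Λ ℏ (starLin Λ ℏ f g) h = starLin Λ ℏ f (starLin Λ ℏ g h) := by
  induction f using MvPolynomial.induction_on generalizing g h with
  | C c => simp only [starLin_C, map_smul, LinearMap.smul_apply]
  | add p q hp hq => simp only [map_add, LinearMap.add_apply, hp, hq]
  | mul_X p a hp =>
    simp only [mul_comm p, starLin_X_mul, map_add, LinearMap.add_apply, map_smul, map_sum,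
      LinearMap.smul_apply, LinearMap.sum_apply, hp, pderiv_starLin, smul_add, sum_add_distrib]
    abel

lemma starP_X_X (i j : σ) :
    starP ℏ Λ (X i) (X j) = X i * X j + C (Complex.I * ℏ / 2 * Λ i j) := by
  classical
  have h := starLin_X_mul Λ ℏ i 1 (X j)
  simp only [mul_one, starLin_one_left, pderiv_X, Pi.single_apply, smul_ite, smul_zero,
    sum_ite_eq, mem_univ, if_true] at h
  rw [← starLin_apply, h, smul_smul, smul_eq_C_mul, mul_one]

lemma starP_commutator (i j : σ) :
    starP ℏ Λ (X i) (X j) - starP ℏ Λ (X j) (X i) =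
      C (Complex.I * ℏ / 2 * (Λ i j - Λ j i)) := by
  rw [starP_X_X, starP_X_X, mul_sub, C_sub]
  ring

end StarProduct

/-- `*_K` makes `ℂ[u₁,…,u_{2m}]` a unital associative ℂ-algebra with unit the
constant polynomial `1`, whose generators satisfy `uᵢ *_K uⱼ − uⱼ *_K uᵢ = iℏ J_{ij}`; in
particular the Weyl algebra relations `[ũ_k, ṽ_l] = −iℏ δ_{kl}`,
`[ũ_k, ũ_l] = 0 = [ṽ_k, ṽ_l]` hold (the `2m` variables are indexed by `Fin m ⊕ Fin m`,
with `ũ_k = X (inl k)` and `ṽ_l = X (inr l)`). -/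
theorem stmt9 (m : ℕ) (ℏ : ℝ) (hℏ : 0 < ℏ)
    (K J : Matrix (Fin m ⊕ Fin m) (Fin m ⊕ Fin m) ℂ)
    (hK : K.IsSymm) (hJ : J = Matrix.fromBlocks 0 (-1) 1 0) :
    -- unit
    (∀ f, starP ℏ (K + J) 1 f = f) ∧
    (∀ f, starP ℏ (K + J) f 1 = f) ∧
    -- bilinearity
    (∀ f g h, starP ℏ (K + J) (f + g) h = starP ℏ (K + J) f h + starP ℏ (K + J) g h) ∧
    (∀ f g h, starP ℏ (K + J) f (g + h) = starP ℏ (K + J) f g + starP ℏ (K + J) f h) ∧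
    (∀ (c : ℂ) f g, starP ℏ (K + J) (c • f) g = c • starP ℏ (K + J) f g) ∧
    (∀ (c : ℂ) f g, starP ℏ (K + J) f (c • g) = c • starP ℏ (K + J) f g) ∧
    -- associativity
    (∀ f g h, starP ℏ (K + J) (starP ℏ (K + J) f g) h
        = starP ℏ (K + J) f (starP ℏ (K + J) g h)) ∧
    -- canonical commutation relations
    (∀ i j : Fin m ⊕ Fin m,
      starP ℏ (K + J) (MvPolynomial.X i) (MvPolynomial.X j)
          - starP ℏ (K + J) (MvPolynomial.X j) (MvPolynomial.X i)
        = MvPolynomial.C (Complex.I * ℏ * J i j)) ∧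
    (∀ k l : Fin m,
      starP ℏ (K + J) (MvPolynomial.X (Sum.inl k)) (MvPolynomial.X (Sum.inr l))
          - starP ℏ (K + J) (MvPolynomial.X (Sum.inr l)) (MvPolynomial.X (Sum.inl k))
        = if k = l then MvPolynomial.C (-(Complex.I * ℏ)) else 0) ∧
    (∀ k l : Fin m,
      starP ℏ (K + J) (MvPolynomial.X (Sum.inl k)) (MvPolynomial.X (Sum.inl l))
        = starP ℏ (K + J) (MvPolynomial.X (Sum.inl l)) (MvPolynomial.X (Sum.inl k))) ∧
    (∀ k l : Fin m,
      starP ℏ (K + J) (MvPolynomial.X (Sum.inr k)) (MvPolynomial.X (Sum.inr l))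
        = starP ℏ (K + J) (MvPolynomial.X (Sum.inr l)) (MvPolynomial.X (Sum.inr k))) := by
  have hcomm (i j : Fin m ⊕ Fin m) :
      starP ℏ (K + J) (MvPolynomial.X i) (MvPolynomial.X j)
          - starP ℏ (K + J) (MvPolynomial.X j) (MvPolynomial.X i)
        = MvPolynomial.C (Complex.I * ℏ * J i j) := by
    have hJ' : J j i = -J i j := by
      subst hJ
      rcases i with i | i <;> rcases j with j | j <;> simp [Matrix.one_apply, eq_comm]
    rw [starP_commutator, Matrix.add_apply, Matrix.add_apply, hK.apply i j, hJ']
    congr 1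
    ring
  refine ⟨starLin_one_left _ _, starLin_one_right _ _, starP_add_left _ _, starP_add_right _ _,
    starP_smul_left _ _, starP_smul_right _ _, starLin_assoc _ _, hcomm, fun k l => ?_,
    fun k l => sub_eq_zero.1 ?_, fun k l => sub_eq_zero.1 ?_⟩
  · rw [hcomm, hJ]
    by_cases h : k = l <;> simp [h]
  · rw [hcomm, hJ]
    simp
  · rw [hcomm, hJ]
    simp

end
end
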